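/- For every ε > 0, the probability (over the exposure process generating the uniform pairing) that P^t(x, π(y)) ≤ (W − ε)/N is o(1/N²) as n → ∞. -/

import Mathlib

open Classical Filter Finset

noncomputable section

/-- The set of half-edges: `deg v` half-edges attached to each vertex `v`. -/
abbrev HE (k : ℕ) (dg : Fin k → ℕ) : Type := (v : Fin k) × Fin (dg v)

/-- A pairing is a fixed-point-free involution of the half-edges. -/
def IsPairing {k : ℕ} {dg : Fin k → ℕ} (π : Equiv.Perm (HE k dg)) : Prop :=
  (∀ x, π (π x) = x) ∧ ∀ x, π x ≠ x

/-- `N`, the total number of half-edges. -/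
def Nh {k : ℕ} (dg : Fin k → ℕ) : ℕ := ∑ v, dg v

/-- The non-backtracking random walk transition matrix: from `x`, move to a uniformly
chosen neighbour of `π x` (a half-edge at the same vertex as `π x`, distinct from it). -/
def nbrwP {k : ℕ} (dg : Fin k → ℕ) (π : Equiv.Perm (HE k dg)) :
    Matrix (HE k dg) (HE k dg) ℝ := fun x y =>
  if (π x).1 = y.1 ∧ π x ≠ y then ((dg (π x).1 : ℝ) - 1)⁻¹ else 0

/-- Total-variation distance to the uniform distribution at time `t`, from state `x`. -/
def Dx {k : ℕ} (dg : Fin k → ℕ) (π : Equiv.Perm (HE k dg)) (x : HE k dg) (t : ℕ) : ℝ :=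
  (1 / 2) * ∑ y, |((nbrwP dg π) ^ t) x y - (Nh dg : ℝ)⁻¹|

/-- Worst-case total-variation distance to equilibrium at time `t`. -/
def Dmax {k : ℕ} (dg : Fin k → ℕ) (π : Equiv.Perm (HE k dg)) (t : ℕ) : ℝ :=
  ⨆ x, Dx dg π x t

/-- Mixing time. -/
def tmixT {k : ℕ} (dg : Fin k → ℕ) (π : Equiv.Perm (HE k dg)) (ε : ℝ) : ℕ :=
  sInf {t : ℕ | Dmax dg π t < ε}

/-- The finite set of all pairings of the half-edges. -/
def PairingsF {k : ℕ} (dg : Fin k → ℕ) : Finset (Equiv.Perm (HE k dg)) :=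
  univ.filter IsPairing

/-- Probability of an event under the uniformly random pairing. -/
def prP {k : ℕ} (dg : Fin k → ℕ) (Q : Equiv.Perm (HE k dg) → Prop) : ℝ :=
  (((PairingsF dg).filter Q).card : ℝ) / ((PairingsF dg).card : ℝ)

/-- Mean logarithmic degree `μ` of a uniform half-edge. -/
def muD {k : ℕ} (dg : Fin k → ℕ) : ℝ :=
  (Nh dg : ℝ)⁻¹ * ∑ v, (dg v : ℝ) * Real.log ((dg v : ℝ) - 1)

/-- Variance `σ²` of the logarithmic degree of a uniform half-edge. -/
def sigsq {k : ℕ} (dg : Fin k → ℕ) : ℝ :=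
  (Nh dg : ℝ)⁻¹ * ∑ v, (dg v : ℝ) * (Real.log ((dg v : ℝ) - 1) - muD dg) ^ 2

/-- Third absolute central moment `ϱ`. -/
def rhoD {k : ℕ} (dg : Fin k → ℕ) : ℝ :=
  (Nh dg : ℝ)⁻¹ * ∑ v, (dg v : ℝ) * |Real.log ((dg v : ℝ) - 1) - muD dg| ^ 3

/-- Maximum degree `Δ`. -/
def DeltaD {k : ℕ} (dg : Fin k → ℕ) : ℕ := univ.sup dg

/-- The standard normal tail function `Φ`. -/
def Phi (lam : ℝ) : ℝ :=
  (Real.sqrt (2 * Real.pi))⁻¹ * ∫ u in Set.Ioi lam, Real.exp (-u ^ 2 / 2)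

/-- Cutoff time `t⋆ = log N / μ`. -/
def tstar {k : ℕ} (dg : Fin k → ℕ) : ℝ := Real.log (Nh dg) / muD dg

/-- Cutoff window `ω⋆ = √(σ² log N / μ³)`. -/
def wstar {k : ℕ} (dg : Fin k → ℕ) : ℝ :=
  Real.sqrt (sigsq dg * Real.log (Nh dg) / (muD dg) ^ 3)

/-- State of the exposure (exploration) process: the forest `F` (with height, weight
and root data for each of its half-edges) and the set of already-paired half-edges. -/
structure ExpState (k : ℕ) (dg : Fin k → ℕ) where
  F : Finset (HE k dg)
  paired : Finset (HE k dg)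
  ht : HE k dg → ℕ
  wt : HE k dg → ℝ
  rt : HE k dg → HE k dg

/-- Lexicographic encoding of half-edges (vertex index first, then half-edge index),
used for tie-breaking. -/
def enc {k : ℕ} (dg : Fin k → ℕ) (z : HE k dg) : ℕ := z.1.val * (Nh dg + 1) + z.2.val

/-- Candidate half-edges for selection: unpaired members of the forest with height
`< tH` and weight `> wmin`. -/
def cands {k : ℕ} {dg : Fin k → ℕ} (tH : ℕ) (wmin : ℝ) (s : ExpState k dg) :
    Finset (HE k dg) :=
  s.F.filter fun z => z ∉ s.paired ∧ s.ht z < tH ∧ wmin < s.wt z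

/-- `z` is the selected half-edge: a candidate of maximal weight, ties broken by the
lexicographic order on half-edges. -/
def IsSelected {k : ℕ} {dg : Fin k → ℕ} (tH : ℕ) (wmin : ℝ) (s : ExpState k dg)
    (z : HE k dg) : Prop :=
  z ∈ cands tH wmin s ∧ (∀ y ∈ cands tH wmin s, s.wt y ≤ s.wt z) ∧
    ∀ y ∈ cands tH wmin s, s.wt y = s.wt z → enc dg z ≤ enc dg y

/-- One step of the exploration stage: select `z`, reveal its partner `z' = π z`, and,
if neither `z'` nor any of its neighbours was already in the forest, attach all
neighbours of `z'` as children of `z`. -/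
def expStep {k : ℕ} {dg : Fin k → ℕ} (π : Equiv.Perm (HE k dg)) (tH : ℕ) (wmin : ℝ)
    (s : ExpState k dg) : ExpState k dg :=
  if hz : ∃ z, IsSelected tH wmin s z then
    let z := Classical.choose hz
    let z' := π z
    if ∀ y ∈ s.F, y.1 ≠ z'.1 then
      { F := s.F ∪ univ.filter (fun w => w.1 = z'.1 ∧ w ≠ z'),
        paired := insert z (insert z' s.paired),
        ht := fun w => if w.1 = z'.1 ∧ w ≠ z' then s.ht z + 1 else s.ht w,
        wt := fun w => if w.1 = z'.1 ∧ w ≠ z' then s.wt z * ((dg z'.1 : ℝ) - 1)⁻¹ else s.wt w,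
        rt := fun w => if w.1 = z'.1 ∧ w ≠ z' then s.rt z else s.rt w }
    else { s with paired := insert z (insert z' s.paired) }
  else s

/-- Initial state of the exposure process: forest reduced to the two roots `x`, `y`. -/
def expInit {k : ℕ} (dg : Fin k → ℕ) (x y : HE k dg) : ExpState k dg :=
  { F := {x, y}, paired := ∅, ht := fun _ => 0, wt := fun _ => 1,
    rt := fun z => if z = y then y else x }

/-- Final state of the exploration stage (the step map is iterated until it
stabilizes, which happens within `N` iterations). -/
def expFinal {k : ℕ} (dg : Fin k → ℕ) (π : Equiv.Perm (HE k dg)) (tH : ℕ) (wmin : ℝ)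
    (x y : HE k dg) : ExpState k dg :=
  (expStep π tH wmin)^[Nh dg] (expInit dg x y)

/-- `H_r`: unpaired half-edges of the forest with height `tH` and root `r`. -/
def Hset {k : ℕ} {dg : Fin k → ℕ} (s : ExpState k dg) (tH : ℕ) (r : HE k dg) :
    Finset (HE k dg) :=
  s.F.filter fun z => z ∉ s.paired ∧ s.ht z = tH ∧ s.rt z = r

/-- `U`: the set of unpaired half-edges of the forest. -/
def Uset {k : ℕ} {dg : Fin k → ℕ} (s : ExpState k dg) : Finset (HE k dg) :=
  s.F.filter fun z => z ∉ s.paired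

/-- `𝔚`: the small-weight part of the pair-weight sum. -/
def Wle {k : ℕ} {dg : Fin k → ℕ} (s : ExpState k dg) (tH : ℕ) (x y : HE k dg)
    (θ : ℝ) : ℝ :=
  ∑ u ∈ Hset s tH x, ∑ v ∈ Hset s tH y,
    if s.wt u * s.wt v ≤ θ then s.wt u * s.wt v else 0

/-- `𝔚̄`: the large-weight part of the pair-weight sum. -/
def Wgt {k : ℕ} {dg : Fin k → ℕ} (s : ExpState k dg) (tH : ℕ) (x y : HE k dg)
    (θ : ℝ) : ℝ :=
  ∑ u ∈ Hset s tH x, ∑ v ∈ Hset s tH y,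
    if θ < s.wt u * s.wt v then s.wt u * s.wt v else 0

/-- The truncation threshold `w_min = N^{-2/3}`. -/
def wminD {k : ℕ} (dg : Fin k → ℕ) : ℝ := (Nh dg : ℝ) ^ (-(2 : ℝ) / 3)

/-- The weight threshold `θ = 1/(N (log N)²)`. -/
def thetaD {k : ℕ} (dg : Fin k → ℕ) : ℝ :=
  ((Nh dg : ℝ) * (Real.log (Nh dg)) ^ 2)⁻¹
theorem laplace_le_of_modification {α ι κ : Type*} [Fintype κ] (C : Finset α) (I : Finset ι)
    (Z : α → ℝ) (c : ι → ℝ) (E : ι → α → Prop) (φ : ι → α → α) (d : ι → α → κ) {D : ℝ}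
    (hc : ∀ i ∈ I, 0 ≤ c i)
    (hZ : ∀ p ∈ C, ∑ i ∈ I, (if E i p then c i else 0) ≤ Z p)
    (hC : ∀ i ∈ I, ∀ p ∈ C, φ i p ∈ C)
    (hE : ∀ i ∈ I, ∀ p ∈ C, E i (φ i p))
    (hD : ∀ i ∈ I, ∀ p ∈ C, Z (φ i p) ≤ Z p + D)
    (hinj : ∀ i ∈ I, Set.InjOn (fun p => (φ i p, d i p)) C)
    {l : ℝ} (hl : 0 ≤ l) :
    (∑ i ∈ I, c i) * (1 - l * D) * ∑ p ∈ C, Real.exp (-l * Z p) ≤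
      Fintype.card κ * ∑ p ∈ C, Z p * Real.exp (-l * Z p) := by
  have key : ∀ i ∈ I, (1 - l * D) * ∑ p ∈ C, Real.exp (-l * Z p) ≤
      Fintype.card κ * ∑ p ∈ C, (if E i p then Real.exp (-l * Z p) else 0) := by
    intro i hi
    set g : α → ℝ := fun p => if E i p then Real.exp (-l * Z p) else 0 with hg
    have hg0 : ∀ p, 0 ≤ g p := fun p => by
      simp only [hg]; split_ifs <;> positivity
    calc (1 - l * D) * ∑ p ∈ C, Real.exp (-l * Z p)
        ≤ ∑ p ∈ C, g (φ i p) := by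
          rw [Finset.mul_sum]
          refine Finset.sum_le_sum fun p hp => ?_
          simp only [hg, if_pos (hE i hi p hp)]
          calc (1 - l * D) * Real.exp (-l * Z p)
              ≤ Real.exp (-(l * D)) * Real.exp (-l * Z p) := by
                gcongr
                linarith [Real.add_one_le_exp (-(l * D))]
            _ ≤ Real.exp (-l * Z (φ i p)) := by
                rw [← Real.exp_add]
                refine Real.exp_le_exp.2 ?_
                nlinarith [mul_le_mul_of_nonneg_left (hD i hi p hp) hl]
      _ = ∑ q ∈ C.image (fun p => (φ i p, d i p)), g q.1 := by
          rw [Finset.sum_image (hinj i hi)]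
      _ ≤ ∑ q ∈ C ×ˢ (univ : Finset κ), g q.1 := by
          refine Finset.sum_le_sum_of_subset_of_nonneg ?_ fun q _ _ => hg0 _
          intro q hq
          obtain ⟨p, hp, rfl⟩ := Finset.mem_image.1 hq
          simp [hC i hi p hp]
      _ = Fintype.card κ * ∑ p ∈ C, g p := by
          rw [Finset.sum_product]
          simp [Finset.mul_sum]
  calc (∑ i ∈ I, c i) * (1 - l * D) * ∑ p ∈ C, Real.exp (-l * Z p)
      = ∑ i ∈ I, c i * ((1 - l * D) * ∑ p ∈ C, Real.exp (-l * Z p)) := by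
        rw [← Finset.sum_mul, mul_assoc]
    _ ≤ ∑ i ∈ I, c i * (Fintype.card κ *
          ∑ p ∈ C, (if E i p then Real.exp (-l * Z p) else 0)) :=
        Finset.sum_le_sum fun i hi => mul_le_mul_of_nonneg_left (key i hi) (hc i hi)
    _ = Fintype.card κ * ∑ p ∈ C, (∑ i ∈ I, (if E i p then c i else 0)) *
          Real.exp (-l * Z p) := by
        simp only [Finset.mul_sum, Finset.sum_mul]
        rw [Finset.sum_comm]
        refine Finset.sum_congr rfl fun p _ => Finset.sum_congr rfl fun i _ => ?_
        split_ifs <;> ring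
    _ ≤ _ := by
        gcongr with p hp
        exact hZ p hp

theorem card_lower_tail_le_of_laplace {α : Type*} (C : Finset α) (Z : α → ℝ) {A D : ℝ}
    (h : ∀ l : ℝ, 0 ≤ l → A * (1 - l * D) * ∑ p ∈ C, Real.exp (-l * Z p) ≤
      ∑ p ∈ C, Z p * Real.exp (-l * Z p)) (a : ℝ) {l : ℝ} (hl : 0 ≤ l) :
    ((C.filter fun p => Z p ≤ a).card : ℝ) ≤
      C.card * Real.exp (l * a - A * (l - l ^ 2 * D / 2)) := by
  set f : ℝ → ℝ := fun l => ∑ p ∈ C, Real.exp (-l * Z p) with hf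
  have hfd : ∀ s, HasDerivAt f (∑ p ∈ C, Real.exp (-s * Z p) * (-1 * Z p)) s := fun s =>
    HasDerivAt.fun_sum fun p _ => ((hasDerivAt_id s).neg.mul_const (Z p)).exp
  have hgd : ∀ s, HasDerivAt (fun s => f s * Real.exp (A * (s - s ^ 2 * D / 2)))
      ((∑ p ∈ C, Real.exp (-s * Z p) * (-1 * Z p)) * Real.exp (A * (s - s ^ 2 * D / 2)) +
        f s * (Real.exp (A * (s - s ^ 2 * D / 2)) * (A * (1 - s * D)))) s := by
    intro s
    refine (hfd s).mul (HasDerivAt.exp (HasDerivAt.const_mul A ?_))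
    exact ((hasDerivAt_id' s).fun_sub ((((hasDerivAt_id' s).fun_pow 2).mul_const D).div_const
      2)).congr_deriv (by push_cast; ring)
  have hanti : AntitoneOn (fun s => f s * Real.exp (A * (s - s ^ 2 * D / 2))) (Set.Ici 0) := by
    refine antitoneOn_of_deriv_nonpos (convex_Ici 0)
      (fun s _ => (hgd s).continuousAt.continuousWithinAt)
      (fun s _ => (hgd s).differentiableAt.differentiableWithinAt) fun s hs => ?_
    rw [interior_Ici] at hs
    rw [(hgd s).deriv]
    have h1 := h s (le_of_lt hs)
    have h2 : ∑ p ∈ C, Real.exp (-s * Z p) * (-1 * Z p) =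
        -∑ p ∈ C, Z p * Real.exp (-s * Z p) := by
      rw [← Finset.sum_neg_distrib]
      exact Finset.sum_congr rfl fun p _ => by ring
    rw [h2]
    have h3 := Real.exp_pos (A * (s - s ^ 2 * D / 2))
    simp only [hf] at *
    nlinarith
  have h0 := hanti (Set.mem_Ici.2 le_rfl) (Set.mem_Ici.2 hl) hl
  have hf0 : f 0 = C.card := by simp [hf]
  have hfl : f l ≤ C.card * Real.exp (-(A * (l - l ^ 2 * D / 2))) := by
    rw [Real.exp_neg, ← div_eq_mul_inv, le_div_iff₀ (Real.exp_pos _)]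
    simpa [hf0] using h0
  calc ((C.filter fun p => Z p ≤ a).card : ℝ)
      = ∑ p ∈ C.filter (fun p => Z p ≤ a), (1 : ℝ) := by simp
    _ ≤ ∑ p ∈ C.filter (fun p => Z p ≤ a), Real.exp (l * a) * Real.exp (-l * Z p) := by
        refine Finset.sum_le_sum fun p hp => ?_
        rw [← Real.exp_add]
        refine Real.one_le_exp ?_
        nlinarith [mul_le_mul_of_nonneg_left (Finset.mem_filter.1 hp).2 hl]
    _ ≤ ∑ p ∈ C, Real.exp (l * a) * Real.exp (-l * Z p) :=
        Finset.sum_le_sum_of_subset_of_nonneg (Finset.filter_subset _ _)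
          fun _ _ _ => by positivity
    _ = Real.exp (l * a) * f l := by rw [Finset.mul_sum]
    _ ≤ Real.exp (l * a) * (C.card * Real.exp (-(A * (l - l ^ 2 * D / 2)))) := by gcongr
    _ = _ := by rw [sub_eq_add_neg (l * a), Real.exp_add]; ring

theorem sum_mul_le_add_of_eq_off {α : Type*} [Fintype α] (A B B' : α → α → ℝ) {θ : ℝ}
    (hA : ∀ u v, 0 ≤ A u v) (hAθ : ∀ u v, A u v ≤ θ) (hB : ∀ u v, 0 ≤ B u v)
    (hB' : ∀ u v, 0 ≤ B' u v) (hrow : ∀ u, ∑ v, B' u v ≤ 1) (hcol : ∀ v, ∑ u, B' u v ≤ 1)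
    (S : Finset α) (hS : ∀ u v, u ∉ S → v ∉ S → B' u v = B u v) :
    ∑ u, ∑ v, A u v * B' u v ≤ ∑ u, ∑ v, A u v * B u v + 2 * S.card * θ := by
  have hpt : ∀ u v, A u v * B' u v ≤ A u v * B u v +
      ((if u ∈ S then θ * B' u v else 0) + (if v ∈ S then θ * B' u v else 0)) := by
    intro u v
    have h1 := mul_nonneg (hA u v) (hB u v)
    have h2 := mul_le_mul_of_nonneg_right (hAθ u v) (hB' u v)
    have h3 := mul_nonneg (hA u v) (hB' u v)
    by_cases hu : u ∈ S <;> by_cases hv : v ∈ S <;> simp only [hu, hv, if_true, if_false]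
    · linarith
    · linarith
    · linarith
    · rw [hS u v hu hv]; linarith
  refine (Finset.sum_le_sum fun u _ => Finset.sum_le_sum fun v _ => hpt u v).trans ?_
  simp only [Finset.sum_add_distrib]
  rcases isEmpty_or_nonempty α with hα | ⟨⟨a⟩⟩
  · have : S = ∅ := Finset.eq_empty_of_isEmpty S
    simp [this]
  have hθ : 0 ≤ θ := (hA a a).trans (hAθ a a)
  have e1 : ∑ u, ∑ v, (if u ∈ S then θ * B' u v else 0) ≤ S.card * θ := by
    have : ∀ u, ∑ v, (if u ∈ S then θ * B' u v else 0) ≤ if u ∈ S then θ else 0 := by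
      intro u
      split_ifs
      · rw [← Finset.mul_sum]
        nlinarith [hrow u]
      · simp
    refine (Finset.sum_le_sum fun u _ => this u).trans ?_
    simp
  have e2 : ∑ u, ∑ v, (if v ∈ S then θ * B' u v else 0) ≤ S.card * θ := by
    rw [Finset.sum_comm]
    have : ∀ v, ∑ u, (if v ∈ S then θ * B' u v else 0) ≤ if v ∈ S then θ else 0 := by
      intro v
      split_ifs
      · rw [← Finset.mul_sum]
        nlinarith [hcol v]
      · simp
    refine (Finset.sum_le_sum fun u _ => this u).trans ?_
    simp
  linarith

section walk

variable {k : ℕ} {dg : Fin k → ℕ} {π : Equiv.Perm (HE k dg)}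

theorem card_neighbours (z : HE k dg) :
    ((univ.filter fun w : HE k dg => w.1 = z.1 ∧ w ≠ z).card : ℝ) = (dg z.1 : ℝ) - 1 := by
  have h1 : (univ.filter fun w : HE k dg => w.1 = z.1 ∧ w ≠ z) =
      ((univ : Finset (Fin (dg z.1))).map (Function.Embedding.sigmaMk z.1)).erase z := by
    ext ⟨v, i⟩
    simp only [mem_filter, mem_univ, true_and, mem_erase, Finset.mem_map,
      Function.Embedding.sigmaMk_apply, ne_eq]
    rw [and_comm]
    refine and_congr_right fun _ => ⟨?_, ?_⟩
    · rintro rfl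
      exact ⟨i, rfl⟩
    · rintro ⟨j, hj⟩
      exact (congrArg Sigma.fst hj).symm
  have hz : z ∈ (univ : Finset (Fin (dg z.1))).map (Function.Embedding.sigmaMk z.1) :=
    Finset.mem_map.2 ⟨z.2, mem_univ _, rfl⟩
  rw [h1, card_erase_of_mem hz, card_map, card_univ, Fintype.card_fin, Nat.cast_sub]
  · simp
  · exact (Nat.zero_le _).trans_lt z.2.isLt

theorem card_HE : Fintype.card (HE k dg) = Nh dg := by
  simp [HE, Nh]

theorem nbrwP_nonneg (hmin : ∀ v, 3 ≤ dg v) (a b : HE k dg) : 0 ≤ nbrwP dg π a b := by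
  unfold nbrwP
  have : (3 : ℝ) ≤ dg (π a).1 := by exact_mod_cast hmin _
  split_ifs
  · exact inv_nonneg.2 (by linarith)
  · exact le_rfl

theorem sum_nbrwP (hmin : ∀ v, 3 ≤ dg v) (a : HE k dg) : ∑ b, nbrwP dg π a b = 1 := by
  unfold nbrwP
  have : (3 : ℝ) ≤ dg (π a).1 := by exact_mod_cast hmin _
  rw [← Finset.sum_filter, Finset.sum_const, nsmul_eq_mul]
  have h := card_neighbours (π a)
  have e : (univ.filter fun b : HE k dg => (π a).1 = b.1 ∧ π a ≠ b) =
      univ.filter fun w : HE k dg => w.1 = (π a).1 ∧ w ≠ π a := by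
    ext b
    simp only [mem_filter, mem_univ, true_and, ne_eq]
    rw [eq_comm, @eq_comm _ (π a) b]
  rw [e, h]
  exact mul_inv_cancel₀ (by linarith)

theorem nbrwP_pow_nonneg (hmin : ∀ v, 3 ≤ dg v) (n : ℕ) (a b : HE k dg) :
    0 ≤ (nbrwP dg π ^ n) a b := by
  induction n generalizing b with
  | zero => rw [pow_zero, Matrix.one_apply]; split_ifs <;> norm_num
  | succ n ih =>
    rw [pow_succ, Matrix.mul_apply]
    exact Finset.sum_nonneg fun c _ => mul_nonneg (ih c) (nbrwP_nonneg hmin c b)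

theorem sum_nbrwP_pow (hmin : ∀ v, 3 ≤ dg v) (n : ℕ) (a : HE k dg) :
    ∑ b, (nbrwP dg π ^ n) a b = 1 := by
  induction n with
  | zero => simp [Matrix.one_apply]
  | succ n ih =>
    simp only [pow_succ, Matrix.mul_apply]
    rw [Finset.sum_comm]
    simp only [← Finset.mul_sum, sum_nbrwP hmin, mul_one, ih]

theorem nbrwP_symm (hπ : IsPairing π) (a b : HE k dg) :
    nbrwP dg π (π b) (π a) = nbrwP dg π a b := by
  unfold nbrwP
  rw [hπ.1 b]
  by_cases h : (π a).1 = b.1 ∧ π a ≠ b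
  · rw [if_pos h, if_pos ⟨h.1.symm, h.2.symm⟩, h.1]
  · rw [if_neg h, if_neg fun h' => h ⟨h'.1.symm, h'.2.symm⟩]

theorem nbrwP_pow_symm (hπ : IsPairing π) (n : ℕ) (a b : HE k dg) :
    (nbrwP dg π ^ n) (π b) (π a) = (nbrwP dg π ^ n) a b := by
  induction n generalizing a b with
  | zero => simp [Matrix.one_apply, eq_comm]
  | succ n ih =>
    rw [pow_succ, Matrix.mul_apply, ← pow_succ, pow_succ', Matrix.mul_apply,
      ← Equiv.sum_comp π]
    refine Finset.sum_congr rfl fun c _ => ?_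
    rw [ih, nbrwP_symm hπ, mul_comm]

theorem nbrwP_pow_symm' (hπ : IsPairing π) (n : ℕ) (a b : HE k dg) :
    (nbrwP dg π ^ n) a (π b) = (nbrwP dg π ^ n) b (π a) := by
  rw [← nbrwP_pow_symm hπ n a (π b), hπ.1]

theorem sum_nbrwP_pow_row (hmin : ∀ v, 3 ≤ dg v) (n : ℕ) (u : HE k dg) :
    ∑ v, (nbrwP dg π ^ n) u (π v) = 1 := by
  rw [Equiv.sum_comp π fun v => (nbrwP dg π ^ n) u v, sum_nbrwP_pow hmin]

theorem sum_nbrwP_pow_col (hmin : ∀ v, 3 ≤ dg v) (hπ : IsPairing π) (n : ℕ) (v : HE k dg) :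
    ∑ u, (nbrwP dg π ^ n) u (π v) = 1 := by
  simp only [nbrwP_pow_symm' hπ n _ v]
  exact sum_nbrwP_pow_row hmin n v

/-- Splitting a walk of length `2 h + r` from `x` to `π y` in the middle, by reversibility. -/
theorem nbrwP_pow_split (hπ : IsPairing π) (h r : ℕ) (x y : HE k dg) :
    (nbrwP dg π ^ (2 * h + r)) x (π y) = ∑ u, ∑ v,
      (nbrwP dg π ^ h) x u * (nbrwP dg π ^ h) y v * (nbrwP dg π ^ r) u (π v) := by
  have e : 2 * h + r = h + (r + h) := by ring
  rw [e, pow_add, Matrix.mul_apply]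
  refine Finset.sum_congr rfl fun u _ => ?_
  rw [pow_add, Matrix.mul_apply, Finset.mul_sum,
    ← Equiv.sum_comp π fun w => (nbrwP dg π ^ h) x u *
      ((nbrwP dg π ^ r) u w * (nbrwP dg π ^ h) w (π y))]
  refine Finset.sum_congr rfl fun v _ => ?_
  rw [nbrwP_pow_symm hπ h y v]
  ring

end walk

section switching

variable {k : ℕ} {dg : Fin k → ℕ} {π : Equiv.Perm (HE k dg)}

/-- The pairing obtained from `π` by the switching that makes `u` and `v` partners of each
other, and makes their former partners `π u` and `π v` partners of each other. -/
def switchPair (π : Equiv.Perm (HE k dg)) (u v : HE k dg) : Equiv.Perm (HE k dg) :=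
  Equiv.swap (π u) v * π * Equiv.swap (π u) v

theorem IsPairing.switchPair (hπ : IsPairing π) (u v : HE k dg) :
    IsPairing (switchPair π u v) := by
  refine ⟨fun z => ?_, fun z hz => ?_⟩
  · simp [_root_.switchPair, hπ.1]
  · refine hπ.2 (Equiv.swap (π u) v z) ?_
    have := congrArg (Equiv.swap (π u) v) hz
    simpa [_root_.switchPair] using this

theorem switchPair_apply_left (hπ : IsPairing π) {u v : HE k dg} (huv : u ≠ v) :
    switchPair π u v u = v := by
  simp [switchPair, Equiv.swap_apply_of_ne_of_ne (hπ.2 u).symm huv]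

theorem switchPair_apply_of_ne (hπ : IsPairing π) {u v z : HE k dg} (h1 : z ≠ u) (h2 : z ≠ v)
    (h3 : z ≠ π u) (h4 : z ≠ π v) : switchPair π u v z = π z := by
  have h5 : π z ≠ π u := fun h => h1 (π.injective h)
  have h6 : π z ≠ v := fun h => h4 (by rw [← h, hπ.1])
  simp [switchPair, Equiv.swap_apply_of_ne_of_ne h3 h2, Equiv.swap_apply_of_ne_of_ne h5 h6]

theorem switchPair_injective {π' : Equiv.Perm (HE k dg)} {u v : HE k dg}
    (h : switchPair π u v = switchPair π' u v) (hu : π u = π' u) : π = π' := by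
  unfold switchPair at h
  rw [hu] at h
  exact mul_left_cancel (mul_right_cancel h)

/-- Pair weights averaged against the `r`-step transitions between the two half-edge balls. -/
def pairSum (A : HE k dg → HE k dg → ℝ) (r : ℕ) (π : Equiv.Perm (HE k dg)) : ℝ :=
  ∑ u, ∑ v, A u v * (nbrwP dg π ^ r) u (π v)

theorem pairSum_switchPair_le (hmin : ∀ v, 3 ≤ dg v) (hπ : IsPairing π)
    {A : HE k dg → HE k dg → ℝ} {θ : ℝ} (hA : ∀ u v, 0 ≤ A u v) (hAθ : ∀ u v, A u v ≤ θ)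
    {r : ℕ} (hr : r ≤ 1) (u v : HE k dg) :
    pairSum A r (switchPair π u v) ≤ pairSum A r π + 8 * θ := by
  have hθ : 0 ≤ θ := (hA u v).trans (hAθ u v)
  have hπ' := hπ.switchPair u v
  have h := sum_mul_le_add_of_eq_off A (fun a b => (nbrwP dg π ^ r) a (π b))
    (fun a b => (nbrwP dg (switchPair π u v) ^ r) a (switchPair π u v b)) hA hAθ
    (fun a b => nbrwP_pow_nonneg hmin _ _ _) (fun a b => nbrwP_pow_nonneg hmin _ _ _)
    (fun a => (sum_nbrwP_pow_row hmin r a).le)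
    (fun a => (sum_nbrwP_pow_col hmin hπ' r a).le) {u, v, π u, π v} (by
      intro a b ha hb
      simp only [mem_insert, mem_singleton, not_or] at ha hb
      have ea := switchPair_apply_of_ne hπ ha.1 ha.2.1 ha.2.2.1 ha.2.2.2
      have eb := switchPair_apply_of_ne hπ hb.1 hb.2.1 hb.2.2.1 hb.2.2.2
      interval_cases r
      · simp [eb]
      · simp [nbrwP, ea, eb])
  have hc : ((({u, v, π u, π v} : Finset (HE k dg)).card : ℕ) : ℝ) ≤ 4 := by
    exact_mod_cast Finset.card_le_four
  unfold pairSum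
  nlinarith

/-- The pairings that agree with `π` on the set `S`. -/
def pairClass (π : Equiv.Perm (HE k dg)) (S : Finset (HE k dg)) :
    Finset (Equiv.Perm (HE k dg)) :=
  (PairingsF dg).filter fun p => ∀ z ∈ S, p z = π z

theorem mem_pairClass {S : Finset (HE k dg)} {p : Equiv.Perm (HE k dg)} :
    p ∈ pairClass π S ↔ IsPairing p ∧ ∀ z ∈ S, p z = π z := by
  simp [pairClass, PairingsF]

theorem switchPair_mem_pairClass {S : Finset (HE k dg)} (hS : ∀ z ∈ S, π z ∈ S)
    {p : Equiv.Perm (HE k dg)} (hp : p ∈ pairClass π S) {u v : HE k dg} (hu : u ∉ S)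
    (hv : v ∉ S) : switchPair p u v ∈ pairClass π S := by
  rw [mem_pairClass] at hp ⊢
  refine ⟨hp.1.switchPair u v, fun z hz => ?_⟩
  have hS' : ∀ w ∈ S, p w ∈ S := fun w hw => by rw [hp.2 w hw]; exact hS w hw
  have hback : ∀ w, w ∉ S → p w ∉ S := fun w hw h => hw (by simpa [hp.1.1] using hS' _ h)
  rw [switchPair_apply_of_ne hp.1, hp.2 z hz]
  · rintro rfl; exact hu hz
  · rintro rfl; exact hv hz
  · rintro rfl; exact hback u hu hz
  · rintro rfl; exact hback v hv hz

theorem laplace_pairSum_zero (hmin : ∀ v, 3 ≤ dg v) {S : Finset (HE k dg)}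
    (hS : ∀ z ∈ S, π z ∈ S) {A : HE k dg → HE k dg → ℝ} {θ : ℝ} (hA : ∀ u v, 0 ≤ A u v)
    (hAθ : ∀ u v, A u v ≤ θ) (hθ : 0 ≤ θ)
    (hAS : ∀ u v, A u v ≠ 0 → u ∉ S ∧ v ∉ S ∧ u ≠ v) {l : ℝ} (hl : 0 ≤ l) :
    (∑ u, ∑ v, A u v) * (1 - l * (16 * θ)) *
        ∑ p ∈ pairClass π S, Real.exp (-l * pairSum A 0 p) ≤
      Nh dg * ∑ p ∈ pairClass π S, pairSum A 0 p * Real.exp (-l * pairSum A 0 p) := by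
  have h := laplace_le_of_modification (D := 16 * θ) (pairClass π S)
    (univ.filter fun i : HE k dg × HE k dg => A i.1 i.2 ≠ 0) (pairSum A 0)
    (fun i => A i.1 i.2) (fun i p => i.1 = p i.2) (fun i p => switchPair p i.1 i.2)
    (fun i p => p i.1) (fun i _ => hA _ _)
    (fun p _ => by
      refine (Finset.sum_le_sum_of_subset_of_nonneg (Finset.filter_subset _ _)
        fun i _ _ => ?_).trans_eq ?_
      · split_ifs
        · exact hA _ _
        · exact le_rfl
      · rw [Fintype.sum_prod_type, pairSum]
        refine Finset.sum_congr rfl fun u _ => Finset.sum_congr rfl fun v _ => ?_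
        simp [Matrix.one_apply])
    (fun i hi p hp => switchPair_mem_pairClass hS hp (hAS _ _ (mem_filter.1 hi).2).1
      (hAS _ _ (mem_filter.1 hi).2).2.1)
    (fun i hi p hp => by
      have hp' := (mem_pairClass.1 hp).1
      have h1 := switchPair_apply_left hp' (hAS _ _ (mem_filter.1 hi).2).2.2
      have h2 := (hp'.switchPair i.1 i.2).1 i.1
      rw [h1] at h2
      exact h2.symm)
    (fun i _ p hp => by
      have := pairSum_switchPair_le hmin (mem_pairClass.1 hp).1 hA hAθ zero_le_one i.1 i.2
      linarith)
    (fun i _ p _ q _ hpq => by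
      simp only [Prod.mk.injEq] at hpq
      exact switchPair_injective hpq.1 hpq.2) hl
  have e : ∑ i ∈ univ.filter (fun i : HE k dg × HE k dg => A i.1 i.2 ≠ 0), A i.1 i.2 =
      ∑ u, ∑ v, A u v := by
    rw [Finset.sum_filter_ne_zero, Fintype.sum_prod_type]
  rwa [e, card_HE] at h

theorem laplace_pairSum_one (hmin : ∀ v, 3 ≤ dg v) {S : Finset (HE k dg)}
    (hS : ∀ z ∈ S, π z ∈ S) {A : HE k dg → HE k dg → ℝ} {θ : ℝ} (hA : ∀ u v, 0 ≤ A u v)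
    (hAθ : ∀ u v, A u v ≤ θ)
    (hAS : ∀ u v, A u v ≠ 0 → u ∉ S ∧ v ∉ S ∧ u ≠ v) {T : Finset (Fin k)}
    (hST : ∀ z ∈ S, z.1 ∈ T) (hAT : ∀ u v, A u v ≠ 0 → u.1 ∈ T ∧ v.1 ∈ T)
    {l : ℝ} (hl : 0 ≤ l) :
    (∑ u, ∑ v, A u v) * (univ.filter fun z : HE k dg => z.1 ∉ T).card *
        (1 - l * (16 * θ)) * ∑ p ∈ pairClass π S, Real.exp (-l * pairSum A 1 p) ≤
      (Nh dg * Nh dg : ℝ) *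
        ∑ p ∈ pairClass π S, pairSum A 1 p * Real.exp (-l * pairSum A 1 p) := by
  set q : HE k dg → HE k dg → ℝ := fun a b =>
    if a.1 ∉ T ∧ b.1 = a.1 ∧ b ≠ a then ((dg a.1 : ℝ) - 1)⁻¹ else 0 with hq
  have hd : ∀ v, (0 : ℝ) < (dg v : ℝ) - 1 := fun v => by
    have : (3 : ℝ) ≤ dg v := by exact_mod_cast hmin v
    linarith
  have hq0 : ∀ a b, 0 ≤ q a b := fun a b => by
    simp only [hq]; split_ifs
    · exact (inv_pos.2 (hd _)).le
    · exact le_rfl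
  have hqP : ∀ (p : Equiv.Perm (HE k dg)) u v, q (p u) (p v) ≤ nbrwP dg p u (p v) := by
    intro p u v
    simp only [hq, nbrwP]
    split_ifs with h1 h2 h2
    · exact le_rfl
    · exact absurd ⟨h1.2.1.symm, h1.2.2.symm⟩ h2
    · exact (inv_pos.2 (hd _)).le
    · exact le_rfl
  have hqsum : ∀ a, ∑ b, q a b = if a.1 ∉ T then 1 else 0 := by
    intro a
    simp only [hq]
    by_cases ha : a.1 ∈ T
    · simp [ha]
    · simp only [ha, not_false_eq_true, true_and, if_true]
      rw [← Finset.sum_filter, Finset.sum_const, nsmul_eq_mul, card_neighbours,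
        mul_inv_cancel₀ (hd _).ne']
  have hI : ∀ i ∈ univ.filter (fun i : (HE k dg × HE k dg) × HE k dg × HE k dg =>
        A i.1.1 i.1.2 * q i.2.1 i.2.2 ≠ 0),
      i.1.1 ∉ S ∧ i.1.2 ∉ S ∧ i.2.1 ∉ S ∧ i.2.2 ∉ S ∧ i.1.1 ≠ i.1.2 ∧ i.1.1 ≠ i.2.1 ∧
        i.1.1 ≠ i.2.2 ∧ i.1.2 ≠ i.2.1 ∧ i.1.2 ≠ i.2.2 ∧ i.2.1 ≠ i.2.2 := by
    intro i hi
    have hi' := (mem_filter.1 hi).2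
    have hAi := left_ne_zero_of_mul hi'
    have hqi := right_ne_zero_of_mul hi'
    obtain ⟨h1, h2, h3⟩ : i.2.1.1 ∉ T ∧ i.2.2.1 = i.2.1.1 ∧ i.2.2 ≠ i.2.1 := by
      by_contra hcon
      exact hqi (if_neg hcon)
    have h4 : i.2.2.1 ∉ T := h2 ▸ h1
    obtain ⟨h5, h6⟩ := hAT _ _ hAi
    obtain ⟨h7, h8, h9⟩ := hAS _ _ hAi
    refine ⟨h7, h8, fun h => h1 (hST _ h), fun h => h4 (hST _ h), h9, ?_, ?_, ?_, ?_, h3.symm⟩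
    · intro h; exact h1 (h ▸ h5)
    · intro h; exact h4 (h ▸ h5)
    · intro h; exact h1 (h ▸ h6)
    · intro h; exact h4 (h ▸ h6)
  have h := laplace_le_of_modification (D := 16 * θ) (pairClass π S)
    (univ.filter (fun i : (HE k dg × HE k dg) × HE k dg × HE k dg =>
        A i.1.1 i.1.2 * q i.2.1 i.2.2 ≠ 0)) (pairSum A 1)
    (fun i => A i.1.1 i.1.2 * q i.2.1 i.2.2) (fun i p => i.2.1 = p i.1.1 ∧ i.2.2 = p i.1.2)
    (fun i p => switchPair (switchPair p i.1.1 i.2.1) i.1.2 i.2.2)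
    (fun i p => (p i.1.1, switchPair p i.1.1 i.2.1 i.1.2))
    (fun i _ => mul_nonneg (hA _ _) (hq0 _ _))
    (fun p _ => by
      refine (Finset.sum_le_sum_of_subset_of_nonneg (Finset.filter_subset _ _)
        fun i _ _ => ?_).trans ?_
      · split_ifs
        · exact mul_nonneg (hA _ _) (hq0 _ _)
        · exact le_rfl
      · rw [Fintype.sum_prod_type, Fintype.sum_prod_type, pairSum]
        refine Finset.sum_le_sum fun u _ => Finset.sum_le_sum fun v _ => ?_
        rw [Fintype.sum_prod_type, pow_one]
        simp only [ite_and]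
        rw [Finset.sum_comm]
        simp only [Finset.sum_ite_eq', mem_univ, if_true]
        exact mul_le_mul_of_nonneg_left (hqP p u v) (hA u v))
    (fun i hi p hp => by
      obtain ⟨h1, h2, h3, h4, -⟩ := hI i hi
      exact switchPair_mem_pairClass hS (switchPair_mem_pairClass hS hp h1 h3) h2 h4)
    (fun i hi p hp => by
      obtain ⟨-, -, -, -, h5, h6, h7, h8, h9, h10⟩ := hI i hi
      have hp1 := (mem_pairClass.1 hp).1.switchPair i.1.1 i.2.1
      have e1 := switchPair_apply_left (mem_pairClass.1 hp).1 h6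
      refine ⟨?_, (switchPair_apply_left hp1 h9).symm⟩
      rw [switchPair_apply_of_ne hp1 h5 h7, e1]
      · intro h
        have h' := hp1.1 i.1.2
        rw [← h, e1] at h'
        exact h8 h'.symm
      · intro h
        have h' := hp1.1 i.2.2
        rw [← h, e1] at h'
        exact h10 h')
    (fun i _ p hp => by
      have hp' := (mem_pairClass.1 hp).1
      have h1 := pairSum_switchPair_le hmin hp' hA hAθ le_rfl i.1.1 i.2.1
      have h2 := pairSum_switchPair_le hmin (hp'.switchPair i.1.1 i.2.1) hA hAθ le_rfl
        i.1.2 i.2.2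
      linarith)
    (fun i _ p _ q _ hpq => by
      simp only [Prod.mk.injEq] at hpq
      exact switchPair_injective (switchPair_injective hpq.1 hpq.2.2) hpq.2.1) hl
  have e : ∑ i ∈ univ.filter (fun i : (HE k dg × HE k dg) × HE k dg × HE k dg =>
        A i.1.1 i.1.2 * q i.2.1 i.2.2 ≠ 0), A i.1.1 i.1.2 * q i.2.1 i.2.2 =
      (∑ u, ∑ v, A u v) * (univ.filter fun z : HE k dg => z.1 ∉ T).card := by
    rw [Finset.sum_filter_ne_zero, Fintype.sum_prod_type, Fintype.sum_prod_type, Finset.sum_mul]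
    refine Finset.sum_congr rfl fun u _ => ?_
    rw [Finset.sum_mul]
    refine Finset.sum_congr rfl fun v _ => ?_
    rw [Fintype.sum_prod_type]
    simp only [← Finset.mul_sum, hqsum]
    rw [Finset.sum_boole]
  rw [e, Fintype.card_prod, card_HE] at h
  exact_mod_cast h

theorem card_pairSum_lower_tail_le (hmin : ∀ v, 3 ≤ dg v) {S : Finset (HE k dg)}
    (hS : ∀ z ∈ S, π z ∈ S) {A : HE k dg → HE k dg → ℝ} {θ : ℝ} (hA : ∀ u v, 0 ≤ A u v)
    (hAθ : ∀ u v, A u v ≤ θ) (hθ : 0 < θ)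
    (hAS : ∀ u v, A u v ≠ 0 → u ∉ S ∧ v ∉ S ∧ u ≠ v) {T : Finset (Fin k)}
    (hST : ∀ z ∈ S, z.1 ∈ T) (hAT : ∀ u v, A u v ≠ 0 → u.1 ∈ T ∧ v.1 ∈ T)
    (hW : ∑ u, ∑ v, A u v ≤ 1) {r : ℕ} (hr : r ≤ 1) (hN : 0 < Nh dg) {ε : ℝ} (hε : 0 < ε)
    (hT : (1 - ε / 2) * Nh dg ≤ (univ.filter fun z : HE k dg => z.1 ∉ T).card) :
    (((pairClass π S).filter fun p =>
        pairSum A r p ≤ (∑ u, ∑ v, A u v - ε) / Nh dg).card : ℝ) ≤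
      (pairClass π S).card * Real.exp (-(ε ^ 2 / (128 * (Nh dg * θ)))) := by
  have hN' : (0 : ℝ) < Nh dg := by exact_mod_cast hN
  set W := ∑ u, ∑ v, A u v with hWdef
  have hW0 : 0 ≤ W := Finset.sum_nonneg fun u _ => Finset.sum_nonneg fun v _ => hA u v
  have hZ0 : ∀ p, 0 ≤ pairSum A r p := fun p =>
    Finset.sum_nonneg fun u _ => Finset.sum_nonneg fun v _ =>
      mul_nonneg (hA u v) (nbrwP_pow_nonneg hmin _ _ _)
  have hT' : ((univ.filter fun z : HE k dg => z.1 ∉ T).card : ℝ) ≤ Nh dg := by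
    rw [← card_HE]
    exact_mod_cast Finset.card_le_univ _
  set U := ((univ.filter fun z : HE k dg => z.1 ∉ T).card : ℝ) with hU
  have hU0 : 0 ≤ U := Nat.cast_nonneg _
  have hlap : ∀ l : ℝ, 0 ≤ l → W * U / (Nh dg * Nh dg) * (1 - l * (16 * θ)) *
      ∑ p ∈ pairClass π S, Real.exp (-l * pairSum A r p) ≤
      ∑ p ∈ pairClass π S, pairSum A r p * Real.exp (-l * pairSum A r p) := by
    intro l hl
    have hf : 0 ≤ ∑ p ∈ pairClass π S, Real.exp (-l * pairSum A r p) :=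
      Finset.sum_nonneg fun _ _ => (Real.exp_pos _).le
    have hg : 0 ≤ ∑ p ∈ pairClass π S, pairSum A r p * Real.exp (-l * pairSum A r p) :=
      Finset.sum_nonneg fun _ _ => mul_nonneg (hZ0 _) (Real.exp_pos _).le
    rcases le_or_gt (1 - l * (16 * θ)) 0 with hs | hs
    · refine le_trans ?_ hg
      exact mul_nonpos_of_nonpos_of_nonneg
        (mul_nonpos_of_nonneg_of_nonpos (by positivity) hs) hf
    · interval_cases r
      · have h := laplace_pairSum_zero (π := π) hmin hS hA hAθ hθ.le hAS hl
        calc W * U / (Nh dg * Nh dg) * (1 - l * (16 * θ)) *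
            ∑ p ∈ pairClass π S, Real.exp (-l * pairSum A 0 p)
            ≤ W * Nh dg / (Nh dg * Nh dg) * (1 - l * (16 * θ)) *
            ∑ p ∈ pairClass π S, Real.exp (-l * pairSum A 0 p) := by gcongr
          _ = (W * (1 - l * (16 * θ)) *
            ∑ p ∈ pairClass π S, Real.exp (-l * pairSum A 0 p)) / Nh dg := by
              field_simp
          _ ≤ _ := by
            rw [div_le_iff₀ hN', mul_comm _ (Nh dg : ℝ)]
            exact h
      · have h := laplace_pairSum_one (π := π) hmin hS hA hAθ hAS hST hAT hl
        calc W * U / (Nh dg * Nh dg) * (1 - l * (16 * θ)) *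
            ∑ p ∈ pairClass π S, Real.exp (-l * pairSum A 1 p)
            = (W * U * (1 - l * (16 * θ)) *
            ∑ p ∈ pairClass π S, Real.exp (-l * pairSum A 1 p)) / (Nh dg * Nh dg) := by ring
          _ ≤ _ := by
            rw [div_le_iff₀ (by positivity), mul_comm _ (Nh dg * Nh dg : ℝ)]
            exact h
  have hl : (0 : ℝ) ≤ ε / (32 * θ) := by positivity
  refine (card_lower_tail_le_of_laplace _ _ hlap _ hl).trans ?_
  refine mul_le_mul_of_nonneg_left (Real.exp_le_exp.2 ?_) (Nat.cast_nonneg _)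
  have hc0 : 0 ≤ U / Nh dg := by positivity
  have hc1 : U / Nh dg ≤ 1 := (div_le_one hN').2 hT'
  have hc2 : 1 - ε / 2 ≤ U / Nh dg := (le_div_iff₀ hN').2 hT
  set c := U / Nh dg with hc
  set l := ε / (32 * θ) with hldef
  have hlθ : l * (32 * θ) = ε := div_mul_cancel₀ _ (by positivity)
  have e1 : l * ((W - ε) / Nh dg) - W * U / (Nh dg * Nh dg) * (l - l ^ 2 * (16 * θ) / 2) =
      (l * (W * (1 - c)) - l * ε + W * c * (l ^ 2 * (8 * θ))) / Nh dg := by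
    rw [hc]; field_simp; ring
  have e2 : -(ε ^ 2 / (128 * (Nh dg * θ))) = (-(l * ε / 4)) / Nh dg := by
    rw [hldef]; field_simp; ring
  rw [e1, e2]
  refine div_le_div_of_nonneg_right ?_ hN'.le
  have h1 : W * (1 - c) ≤ 1 * (ε / 2) := by
    refine mul_le_mul hW (by linarith) (by linarith) zero_le_one
  have h2 : W * c ≤ 1 := mul_le_one₀ hW hc0 hc1
  have h3 : l ^ 2 * (8 * θ) = l * ε / 4 := by rw [← hlθ]; ring
  have h4 : 0 ≤ l * ε / 4 := by positivity
  rw [h3]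
  nlinarith [mul_le_mul_of_nonneg_left h1 hl, mul_le_mul_of_nonneg_right h2 h4]

end switching

section exploration

variable {k : ℕ} {dg : Fin k → ℕ} {π : Equiv.Perm (HE k dg)}

/-- The state after revealing that the partner of `z` is `z'`. -/
def exposePair (s : ExpState k dg) (z z' : HE k dg) : ExpState k dg :=
  if ∀ y ∈ s.F, y.1 ≠ z'.1 then
    { F := s.F ∪ univ.filter (fun w => w.1 = z'.1 ∧ w ≠ z'),
      paired := insert z (insert z' s.paired),
      ht := fun w => if w.1 = z'.1 ∧ w ≠ z' then s.ht z + 1 else s.ht w,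
      wt := fun w => if w.1 = z'.1 ∧ w ≠ z' then s.wt z * ((dg z'.1 : ℝ) - 1)⁻¹ else s.wt w,
      rt := fun w => if w.1 = z'.1 ∧ w ≠ z' then s.rt z else s.rt w }
  else { s with paired := insert z (insert z' s.paired) }

theorem expStep_eq_self_or_exposePair (tH : ℕ) (wmin : ℝ) (s : ExpState k dg) :
    (∀ p, expStep p tH wmin s = s) ∨ ∃ z, IsSelected tH wmin s z ∧
      ∀ p : Equiv.Perm (HE k dg), expStep p tH wmin s = exposePair s z (p z) := by
  by_cases hz : ∃ z, IsSelected tH wmin s z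
  · exact Or.inr ⟨Classical.choose hz, Classical.choose_spec hz, fun p => by
      rw [expStep, dif_pos hz]; rfl⟩
  · exact Or.inl fun p => by rw [expStep, dif_neg hz]

theorem exposePair_paired (s : ExpState k dg) (z z' : HE k dg) :
    (exposePair s z z').paired = insert z (insert z' s.paired) := by
  unfold exposePair
  split_ifs <;> rfl

/-- The exploration up to any stage depends only on the partners it has revealed. -/
theorem expStep_iterate_congr {p : Equiv.Perm (HE k dg)} (tH : ℕ) (wmin : ℝ)
    (s : ExpState k dg) (m : ℕ)
    (h : ∀ z ∈ ((expStep π tH wmin)^[m] s).paired, p z = π z) :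
    (expStep p tH wmin)^[m] s = (expStep π tH wmin)^[m] s := by
  induction m with
  | zero => rfl
  | succ m ih =>
    rw [Function.iterate_succ_apply'] at h ⊢
    rw [Function.iterate_succ_apply']
    rcases expStep_eq_self_or_exposePair tH wmin ((expStep π tH wmin)^[m] s) with h1 | ⟨z, -, h1⟩
    · rw [h1] at h
      rw [ih h, h1, h1]
    · rw [h1, exposePair_paired] at h
      rw [ih fun w hw => h w (by simp [hw]), h1, h1, h z (by simp)]

/-- Invariants of the exploration from the roots `x` and `y`. -/
structure ExpInvariant (π : Equiv.Perm (HE k dg)) (x y : HE k dg) (K : ℕ) (wmin : ℝ)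
    (s : ExpState k dg) : Prop where
  wt_nonneg : ∀ z ∈ s.F, 0 ≤ s.wt z
  wt_le_pow : ∀ z ∈ s.F, s.wt z ≤ (1 / 2) ^ s.ht z
  wt_le_nbrwP : ∀ z ∈ s.F, s.wt z ≤ (nbrwP dg π ^ s.ht z) (s.rt z) z
  ht_le : ∀ z ∈ s.F, s.ht z ≤ K
  paired_closed : ∀ z ∈ s.paired, π z ∈ s.paired
  vertex_mem : ∀ z ∈ s.F, z.1 ∈ (insert x (insert y s.paired)).image Sigma.fst
  potential : ∑ z ∈ s.F \ s.paired, s.wt z * (K - s.ht z) + wmin / 2 * s.paired.card ≤ 2 * K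

theorem expInvariant_expInit (x y : HE k dg) (K : ℕ) (wmin : ℝ) :
    ExpInvariant π x y K wmin (expInit dg x y) where
  wt_nonneg z _ := zero_le_one
  wt_le_pow z _ := by simp [expInit]
  wt_le_nbrwP z hz := by
    have hz' : z = x ∨ z = y := by simpa [expInit] using hz
    have : (expInit dg x y).rt z = z := by
      rcases hz' with rfl | rfl
      · by_cases h : z = y <;> simp [expInit, h]
      · simp [expInit]
    rw [this]
    simp [expInit]
  ht_le z _ := Nat.zero_le _
  paired_closed z hz := by simp [expInit] at hz
  vertex_mem z hz := by
    have hz' : z = x ∨ z = y := by simpa [expInit] using hz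
    exact mem_image_of_mem _ (by rcases hz' with rfl | rfl <;> simp)
  potential := by
    have h : ((({x, y} : Finset (HE k dg)).card : ℕ) : ℝ) ≤ 2 := by
      exact_mod_cast Finset.card_le_two
    simp only [expInit, sdiff_empty, Finset.sum_const, card_empty, Nat.cast_zero, mul_zero,
      add_zero, sub_zero, one_mul, nsmul_eq_mul]
    gcongr

theorem ExpInvariant.exposePair (hmin : ∀ v, 3 ≤ dg v) (hπ : IsPairing π) {x y : HE k dg}
    {K : ℕ} {wmin : ℝ} (hw : 0 ≤ wmin) (hK : ∀ h : ℕ, wmin < (1 / 2) ^ h → h < K)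
    {s : ExpState k dg} (hs : ExpInvariant π x y K wmin s) {z : HE k dg} (hzF : z ∈ s.F)
    (hzp : z ∉ s.paired) (hzw : wmin < s.wt z) :
    ExpInvariant π x y K wmin (exposePair s z (π z)) := by
  have hzK : s.ht z < K := hK _ (hzw.trans_le (hs.wt_le_pow z hzF))
  have hzK' : (s.ht z : ℝ) + 1 ≤ K := by exact_mod_cast hzK
  have hz0 := hs.wt_nonneg z hzF
  have hd : (2 : ℝ) ≤ (dg (π z).1 : ℝ) - 1 := by
    have : (3 : ℝ) ≤ dg (π z).1 := by exact_mod_cast hmin _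
    linarith
  have hclosed : ∀ w ∈ insert z (insert (π z) s.paired),
      π w ∈ insert z (insert (π z) s.paired) := by
    intro w hw
    simp only [mem_insert] at hw ⊢
    rcases hw with rfl | rfl | hw
    · exact Or.inr (Or.inl rfl)
    · exact Or.inl (hπ.1 _)
    · exact Or.inr (Or.inr (hs.paired_closed w hw))
  have hcard : ((insert z (insert (π z) s.paired)).card : ℝ) ≤ s.paired.card + 2 := by
    have h1 := card_insert_le z (insert (π z) s.paired)
    have h2 := card_insert_le (π z) s.paired
    exact_mod_cast h1.trans (Nat.add_le_add_right h2 1)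
  have hcard' : wmin / 2 * ((insert z (insert (π z) s.paired)).card : ℝ) ≤
      wmin / 2 * s.paired.card + wmin := by
    nlinarith [mul_le_mul_of_nonneg_left hcard (div_nonneg hw zero_le_two)]
  have hsub : (insert x (insert y s.paired)).image Sigma.fst ⊆
      (insert x (insert y (insert z (insert (π z) s.paired)))).image Sigma.fst := by
    refine image_subset_image fun w hw => ?_
    simp only [mem_insert] at hw ⊢
    tauto
  have hpot0 : ∀ w ∈ s.F, 0 ≤ s.wt w * (K - s.ht w) := fun w hw =>
    mul_nonneg (hs.wt_nonneg w hw) (sub_nonneg.2 (by exact_mod_cast hs.ht_le w hw))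
  have hdrop : ∑ w ∈ s.F \ insert z (insert (π z) s.paired), s.wt w * (K - s.ht w) ≤
      ∑ w ∈ s.F \ s.paired, s.wt w * (K - s.ht w) - s.wt z * (K - s.ht z) := by
    have hzm : z ∈ s.F \ s.paired := Finset.mem_sdiff.2 ⟨hzF, hzp⟩
    rw [← Finset.add_sum_erase _ _ hzm, add_sub_cancel_left]
    refine Finset.sum_le_sum_of_subset_of_nonneg ?_ fun w hw _ =>
      hpot0 w (Finset.mem_sdiff.1 (mem_of_mem_erase hw)).1
    intro w hw
    simp only [Finset.mem_sdiff, mem_insert, not_or] at hw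
    exact mem_erase.2 ⟨hw.2.1, Finset.mem_sdiff.2 ⟨hw.1, hw.2.2.2⟩⟩
  have hpot := hs.potential
  by_cases hnew : ∀ y ∈ s.F, y.1 ≠ (π z).1
  · have hold : ∀ w ∈ s.F, ¬(w.1 = (π z).1 ∧ w ≠ π z) := fun w hw h => hnew w hw h.1
    unfold _root_.exposePair
    rw [if_pos hnew]
    refine ⟨?_, ?_, ?_, ?_, hclosed, ?_, ?_⟩
    · intro w hw
      rcases mem_union.1 hw with hw | hw
      · simpa only [if_neg (hold w hw)] using hs.wt_nonneg w hw
      · simp only [if_pos (mem_filter.1 hw).2]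
        exact mul_nonneg hz0 (inv_nonneg.2 (by linarith))
    · intro w hw
      rcases mem_union.1 hw with hw | hw
      · simpa only [if_neg (hold w hw)] using hs.wt_le_pow w hw
      · simp only [if_pos (mem_filter.1 hw).2, pow_succ]
        refine mul_le_mul (hs.wt_le_pow z hzF) ?_ (inv_nonneg.2 (by linarith)) (by positivity)
        rw [one_div]
        exact inv_anti₀ two_pos hd
    · intro w hw
      rcases mem_union.1 hw with hw | hw
      · simpa only [if_neg (hold w hw)] using hs.wt_le_nbrwP w hw
      · have hw' := (mem_filter.1 hw).2
        simp only [if_pos hw']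
        have hP : nbrwP dg π z w = ((dg (π z).1 : ℝ) - 1)⁻¹ := by
          rw [nbrwP, if_pos ⟨hw'.1.symm, hw'.2.symm⟩]
        rw [pow_succ, Matrix.mul_apply, ← hP]
        calc s.wt z * nbrwP dg π z w
            ≤ (nbrwP dg π ^ s.ht z) (s.rt z) z * nbrwP dg π z w :=
              mul_le_mul_of_nonneg_right (hs.wt_le_nbrwP z hzF) (nbrwP_nonneg hmin _ _)
          _ ≤ _ := Finset.single_le_sum
              (f := fun c => (nbrwP dg π ^ s.ht z) (s.rt z) c * nbrwP dg π c w)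
              (fun c _ => mul_nonneg (nbrwP_pow_nonneg hmin _ _ _) (nbrwP_nonneg hmin _ _))
              (mem_univ z)
    · intro w hw
      rcases mem_union.1 hw with hw | hw
      · simpa only [if_neg (hold w hw)] using hs.ht_le w hw
      · simpa only [if_pos (mem_filter.1 hw).2] using Nat.succ_le_of_lt hzK
    · intro w hw
      rcases mem_union.1 hw with hw | hw
      · exact hsub (hs.vertex_mem w hw)
      · rw [(mem_filter.1 hw).2.1]
        exact mem_image_of_mem _ (by simp)
    · dsimp only
      set ch : Finset (HE k dg) := univ.filter fun w => w.1 = (π z).1 ∧ w ≠ π z with hch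
      set g : HE k dg → ℝ := fun w =>
        (if w.1 = (π z).1 ∧ w ≠ π z then s.wt z * ((dg (π z).1 : ℝ) - 1)⁻¹ else s.wt w) *
          (K - ((if w.1 = (π z).1 ∧ w ≠ π z then s.ht z + 1 else s.ht w : ℕ) : ℝ)) with hg
      have hgF : ∀ w ∈ s.F, g w = s.wt w * (K - s.ht w) := fun w hw => by
        simp only [hg, if_neg (hold w hw)]
      have hgch : ∀ w ∈ ch, g w =
          s.wt z * ((dg (π z).1 : ℝ) - 1)⁻¹ * (K - (s.ht z + 1)) := fun w hw => by
        simp only [hg, if_pos (mem_filter.1 hw).2]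
        push_cast
        ring
      have hchpos : ∀ w ∈ ch, 0 ≤ g w := fun w hw => by
        rw [hgch w hw]
        exact mul_nonneg (mul_nonneg hz0 (inv_nonneg.2 (by linarith))) (by linarith)
      have hsumch : ∑ w ∈ ch, g w = s.wt z * (K - (s.ht z + 1)) := by
        rw [Finset.sum_congr rfl hgch, Finset.sum_const, nsmul_eq_mul, hch, card_neighbours]
        field_simp
      have hdisj : Disjoint (s.F \ insert z (insert (π z) s.paired)) ch := by
        rw [Finset.disjoint_left]
        intro w hw hw'
        exact hold w (Finset.mem_sdiff.1 hw).1 (mem_filter.1 hw').2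
      have hsum : ∑ w ∈ (s.F ∪ ch) \ insert z (insert (π z) s.paired), g w ≤
          ∑ w ∈ (s.F \ insert z (insert (π z) s.paired)) ∪ ch, g w := by
        refine Finset.sum_le_sum_of_subset_of_nonneg ?_ ?_
        · intro w hw
          simp only [Finset.mem_sdiff, mem_union] at hw ⊢
          tauto
        · intro w hw _
          rcases mem_union.1 hw with hw | hw
          · rw [hgF w (Finset.mem_sdiff.1 hw).1]
            exact hpot0 w (Finset.mem_sdiff.1 hw).1
          · exact hchpos w hw
      rw [Finset.sum_union hdisj, hsumch,
        Finset.sum_congr rfl fun w hw => hgF w (Finset.mem_sdiff.1 hw).1] at hsum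
      linarith
  · unfold _root_.exposePair
    rw [if_neg hnew]
    refine ⟨hs.wt_nonneg, hs.wt_le_pow, hs.wt_le_nbrwP, hs.ht_le, hclosed,
      fun w hw => hsub (hs.vertex_mem w hw), ?_⟩
    dsimp only
    have : s.wt z * 1 ≤ s.wt z * (K - s.ht z) :=
      mul_le_mul_of_nonneg_left (by linarith) hz0
    linarith

theorem expInvariant_expFinal (hmin : ∀ v, 3 ≤ dg v) (hπ : IsPairing π) (x y : HE k dg)
    {K : ℕ} (tH : ℕ) {wmin : ℝ} (hw : 0 ≤ wmin) (hK : ∀ h : ℕ, wmin < (1 / 2) ^ h → h < K) :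
    ExpInvariant π x y K wmin (expFinal dg π tH wmin x y) := by
  unfold expFinal
  generalize Nh dg = m
  induction m with
  | zero => exact expInvariant_expInit x y K wmin
  | succ m ih =>
    rw [Function.iterate_succ_apply']
    rcases expStep_eq_self_or_exposePair tH wmin
      ((expStep π tH wmin)^[m] (expInit dg x y)) with h | ⟨z, hz, h⟩
    · rwa [h]
    · rw [h]
      have hz' := mem_filter.1 hz.1
      exact ih.exposePair hmin hπ hw hK hz'.1 hz'.2.1 hz'.2.2.2

/-- The truncated products of weights that enter `Wle`. -/
def pairWeight (s : ExpState k dg) (tH : ℕ) (x y : HE k dg) (θ : ℝ) (u v : HE k dg) : ℝ :=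
  if (u ∈ Hset s tH x ∧ v ∈ Hset s tH y) ∧ s.wt u * s.wt v ≤ θ then s.wt u * s.wt v else 0

theorem sum_pairWeight (s : ExpState k dg) (tH : ℕ) (x y : HE k dg) (θ : ℝ) :
    ∑ u, ∑ v, pairWeight s tH x y θ u v = Wle s tH x y θ := by
  have h : ∀ u, ∑ v, pairWeight s tH x y θ u v = if u ∈ Hset s tH x then
      ∑ v ∈ Hset s tH y, (if s.wt u * s.wt v ≤ θ then s.wt u * s.wt v else 0) else 0 := by
    intro u
    simp only [pairWeight, ite_and]
    split_ifs
    · rw [Finset.sum_ite_mem, Finset.univ_inter]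
    · simp
  simp only [h, Wle]
  rw [Finset.sum_ite_mem, Finset.univ_inter]

theorem card_vertices_notMem_ge (s : ExpState k dg) (x y : HE k dg) :
    (Nh dg : ℝ) - DeltaD dg * (s.paired.card + 2) ≤ (univ.filter fun z : HE k dg =>
      z.1 ∉ (insert x (insert y s.paired)).image Sigma.fst).card := by
  set T := (insert x (insert y s.paired)).image Sigma.fst with hT
  have h1 : (univ.filter fun z : HE k dg => z.1 ∈ T).card ≤ DeltaD dg * T.card := by
    have : (univ.filter fun z : HE k dg => z.1 ∈ T) =
        T.sigma fun v => (univ : Finset (Fin (dg v))) := by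
      ext z; simp
    rw [this, card_sigma, mul_comm]
    refine Finset.sum_le_card_nsmul _ _ _ fun v _ => ?_
    rw [card_univ, Fintype.card_fin]
    exact Finset.le_sup (f := dg) (mem_univ v)
  have h2 : T.card ≤ s.paired.card + 2 := by
    refine card_image_le.trans ((card_insert_le _ _).trans ?_)
    have := card_insert_le y s.paired
    omega
  have h3 := Finset.card_filter_add_card_filter_not (s := (univ : Finset (HE k dg)))
    (fun z => z.1 ∈ T)
  rw [card_univ, card_HE] at h3
  have h4 : (Nh dg : ℝ) ≤ DeltaD dg * (s.paired.card + 2) +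
      (univ.filter fun z : HE k dg => z.1 ∉ T).card := by
    rw [← h3]
    push_cast
    gcongr
    exact_mod_cast h1.trans (Nat.mul_le_mul_left _ h2)
  linarith

theorem ExpInvariant.pairWeight_le {x y : HE k dg} {K : ℕ} {wmin : ℝ} {s : ExpState k dg}
    (hmin : ∀ v, 3 ≤ dg v) (hs : ExpInvariant π x y K wmin s) (tH : ℕ) (θ : ℝ) (u v : HE k dg) :
    pairWeight s tH x y θ u v ≤ (nbrwP dg π ^ tH) x u * (nbrwP dg π ^ tH) y v := by
  unfold pairWeight
  split_ifs with h
  · obtain ⟨huF, -, rfl, rfl⟩ := mem_filter.1 h.1.1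
    obtain ⟨hvF, -, hv, rfl⟩ := mem_filter.1 h.1.2
    have h1 := hs.wt_le_nbrwP v hvF
    rw [hv] at h1
    exact mul_le_mul (hs.wt_le_nbrwP u huF) h1 (hs.wt_nonneg v hvF)
      (nbrwP_pow_nonneg hmin _ _ _)
  · exact mul_nonneg (nbrwP_pow_nonneg hmin _ _ _) (nbrwP_pow_nonneg hmin _ _ _)

theorem ExpInvariant.sum_pairWeight_le_one {x y : HE k dg} {K : ℕ} {wmin : ℝ}
    {s : ExpState k dg} (hmin : ∀ v, 3 ≤ dg v) (hs : ExpInvariant π x y K wmin s) (tH : ℕ)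
    (θ : ℝ) : ∑ u, ∑ v, pairWeight s tH x y θ u v ≤ 1 := by
  refine (Finset.sum_le_sum fun u _ => Finset.sum_le_sum fun v _ =>
    hs.pairWeight_le hmin tH θ u v).trans_eq ?_
  simp only [← Finset.mul_sum, sum_nbrwP_pow hmin, mul_one]

/-- The `t`-step transition probability from `x` to `π y` is at least the `pairSum` of the
truncated weights collected by the exploration. -/
theorem ExpInvariant.pairSum_le {x y : HE k dg} {K : ℕ} {wmin : ℝ} {s : ExpState k dg}
    (hmin : ∀ v, 3 ≤ dg v) (hπ : IsPairing π) (hs : ExpInvariant π x y K wmin s) (t : ℕ)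
    (θ : ℝ) : pairSum (pairWeight s (t / 2) x y θ) (t % 2) π ≤ (nbrwP dg π ^ t) x (π y) := by
  conv_rhs => rw [← Nat.div_add_mod t 2, nbrwP_pow_split hπ]
  exact Finset.sum_le_sum fun u _ => Finset.sum_le_sum fun v _ =>
    mul_le_mul_of_nonneg_right (hs.pairWeight_le hmin _ θ u v) (nbrwP_pow_nonneg hmin _ _ _)

theorem card_pairClass_expFinal_lower_tail_le (hmin : ∀ v, 3 ≤ dg v) (hπ : IsPairing π)
    {x y : HE k dg} (hxy : x ≠ y) (t : ℕ) {K : ℕ} {wmin θ ε : ℝ} (hw : 0 < wmin)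
    (hK : ∀ h : ℕ, wmin < (1 / 2) ^ h → h < K) (hθ : 0 < θ) (hε : 0 < ε) (hN : 0 < Nh dg)
    (hΔ : DeltaD dg * (4 * K / wmin + 2) ≤ ε / 2 * Nh dg) :
    (((pairClass π (expFinal dg π (t / 2) wmin x y).paired).filter fun p =>
        (nbrwP dg p ^ t) x (p y) ≤
          (Wle (expFinal dg p (t / 2) wmin x y) (t / 2) x y θ - ε) / Nh dg).card : ℝ) ≤
      (pairClass π (expFinal dg π (t / 2) wmin x y).paired).card *
        Real.exp (-(ε ^ 2 / (128 * (Nh dg * θ)))) := by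
  have hs := expInvariant_expFinal hmin hπ x y (t / 2) hw.le hK
  set s := expFinal dg π (t / 2) wmin x y with hsdef
  have hA0 : ∀ u v, 0 ≤ pairWeight s (t / 2) x y θ u v := fun u v => by
    unfold pairWeight
    split_ifs with h
    · exact mul_nonneg (hs.wt_nonneg _ (mem_filter.1 h.1.1).1)
        (hs.wt_nonneg _ (mem_filter.1 h.1.2).1)
    · exact le_rfl
  have hAθ : ∀ u v, pairWeight s (t / 2) x y θ u v ≤ θ := fun u v => by
    unfold pairWeight
    split_ifs with h
    · exact h.2
    · exact hθ.le
  have hAH : ∀ u v, pairWeight s (t / 2) x y θ u v ≠ 0 →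
      u ∈ Hset s (t / 2) x ∧ v ∈ Hset s (t / 2) y := by
    intro u v h
    by_contra hcon
    exact h (if_neg fun h' => hcon h'.1)
  have hcard : (s.paired.card : ℝ) ≤ 4 * K / wmin := by
    have h0 : 0 ≤ ∑ z ∈ s.F \ s.paired, s.wt z * (K - s.ht z) :=
      Finset.sum_nonneg fun z hz => mul_nonneg (hs.wt_nonneg z (Finset.mem_sdiff.1 hz).1)
        (sub_nonneg.2 (by exact_mod_cast hs.ht_le z (Finset.mem_sdiff.1 hz).1))
    rw [le_div_iff₀ hw]
    linarith [hs.potential]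
  have hT := card_vertices_notMem_ge s x y
  have hΔ' : DeltaD dg * ((s.paired.card : ℝ) + 2) ≤ ε / 2 * Nh dg :=
    (mul_le_mul_of_nonneg_left (by linarith) (Nat.cast_nonneg _)).trans hΔ
  have h := card_pairSum_lower_tail_le (π := π) (r := t % 2) hmin hs.paired_closed hA0 hAθ hθ
    (fun u v h => by
      obtain ⟨hu, hv⟩ := hAH u v h
      refine ⟨(mem_filter.1 hu).2.1, (mem_filter.1 hv).2.1, ?_⟩
      rintro rfl
      exact hxy ((mem_filter.1 hu).2.2.2.symm.trans (mem_filter.1 hv).2.2.2))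
    (T := (insert x (insert y s.paired)).image Sigma.fst)
    (fun z hz => mem_image_of_mem _ (by simp [hz]))
    (fun u v h => ⟨hs.vertex_mem u (mem_filter.1 (hAH u v h).1).1,
      hs.vertex_mem v (mem_filter.1 (hAH u v h).2).1⟩)
    (hs.sum_pairWeight_le_one hmin _ θ) (Nat.lt_succ_iff.1 (Nat.mod_lt t two_pos)) hN hε
    (by linarith)
  refine le_trans ?_ h
  norm_cast
  refine card_le_card fun p hp => ?_
  obtain ⟨hpC, hp⟩ := mem_filter.1 hp
  obtain ⟨hpp, hpS⟩ := mem_pairClass.1 hpC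
  have hst : expFinal dg p (t / 2) wmin x y = s := expStep_iterate_congr _ _ _ _ hpS
  have hsp := expInvariant_expFinal hmin hpp x y (t / 2) hw.le hK
  rw [hst] at hp hsp
  refine mem_filter.2 ⟨hpC, ?_⟩
  rw [sum_pairWeight]
  exact (hsp.pairSum_le hmin hpp t θ).trans hp

theorem prP_lower_tail_le (hmin : ∀ v, 3 ≤ dg v)
    {x y : HE k dg} (hxy : x ≠ y) (t : ℕ) {K : ℕ} {wmin θ ε : ℝ} (hw : 0 < wmin)
    (hK : ∀ h : ℕ, wmin < (1 / 2) ^ h → h < K) (hθ : 0 < θ) (hε : 0 < ε) (hN : 0 < Nh dg)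
    (hΔ : DeltaD dg * (4 * K / wmin + 2) ≤ ε / 2 * Nh dg) :
    prP dg (fun p => (nbrwP dg p ^ t) x (p y) ≤
          (Wle (expFinal dg p (t / 2) wmin x y) (t / 2) x y θ - ε) / Nh dg) ≤
      Real.exp (-(ε ^ 2 / (128 * (Nh dg * θ)))) := by
  set Q : Equiv.Perm (HE k dg) → Prop := fun p => (nbrwP dg p ^ t) x (p y) ≤
          (Wle (expFinal dg p (t / 2) wmin x y) (t / 2) x y θ - ε) / Nh dg with hQ
  set S : Equiv.Perm (HE k dg) → Finset (HE k dg) := fun p =>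
    (expFinal dg p (t / 2) wmin x y).paired with hS
  set f : Equiv.Perm (HE k dg) → HE k dg → Option (HE k dg) := fun p z =>
    if z ∈ S p then some (p z) else none with hf
  have hfiber : ∀ p, (PairingsF dg).filter (fun q => f q = f p) = pairClass p (S p) := by
    intro p
    ext q
    simp only [pairClass, mem_filter, and_congr_right_iff]
    intro _
    constructor
    · intro h z hz
      have hz' := congrFun h z
      simp only [hf, if_pos hz] at hz'
      split_ifs at hz'
      exact Option.some.inj hz'
    · intro h
      have hSq : S q = S p := by
        simp only [hS]
        exact congrArg ExpState.paired (expStep_iterate_congr _ _ _ _ h)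
      funext z
      simp only [hf, hSq]
      split_ifs with hz
      · rw [h z hz]
      · rfl
  have hmaps : ∀ p ∈ PairingsF dg, f p ∈ (PairingsF dg).image f := fun p hp =>
    mem_image_of_mem f hp
  unfold prP
  refine div_le_of_le_mul₀ (Nat.cast_nonneg _) (Real.exp_pos _).le ?_
  rw [Finset.card_eq_sum_card_fiberwise (s := (PairingsF dg).filter Q) (f := f)
      (t := (PairingsF dg).image f) (fun p hp => hmaps p (mem_filter.1 hp).1),
    Finset.card_eq_sum_card_fiberwise (s := PairingsF dg) (f := f)
      (t := (PairingsF dg).image f) hmaps]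
  push_cast
  rw [Finset.mul_sum]
  refine Finset.sum_le_sum fun b hb => ?_
  obtain ⟨p, hp, rfl⟩ := mem_image.1 hb
  rw [Finset.filter_comm, hfiber, mul_comm]
  exact card_pairClass_expFinal_lower_tail_le hmin (mem_filter.1 hp).2 hxy t hw hK hθ hε hN hΔ

end exploration

theorem lt_log_of_rpow_lt_pow {N : ℕ} (hN : 0 < N) (h : ℕ)
    (hlt : (N : ℝ) ^ (-(2 : ℝ) / 3) < (1 / 2) ^ h) : h < Nat.log 2 N + 1 := by
  have hN1 : (1 : ℝ) ≤ N := by exact_mod_cast hN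
  have h1 : (N : ℝ)⁻¹ ≤ (N : ℝ) ^ (-(2 : ℝ) / 3) := by
    rw [← Real.rpow_neg_one]
    exact Real.rpow_le_rpow_of_exponent_le hN1 (by norm_num)
  have h2 : (N : ℝ)⁻¹ < ((2 : ℝ) ^ h)⁻¹ := by
    rw [← inv_pow, ← one_div (2 : ℝ)]
    exact h1.trans_lt hlt
  have h3 : (2 : ℝ) ^ h < N := (inv_lt_inv₀ (by linarith) (by positivity)).1 h2
  have h4 : 2 ^ h < N := by exact_mod_cast h3
  exact Nat.lt_succ_of_le (Nat.le_log_of_pow_le one_lt_two h4.le)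

theorem eventually_degree_bound {ε : ℝ} (hε : 0 < ε) : ∀ᶠ r : ℝ in atTop, ∀ N : ℕ, 0 < N →
    r = N → ∀ Δ : ℝ, Δ ≤ (N : ℝ) ^ (1 / 6 : ℝ) →
      Δ * (4 * ((Nat.log 2 N + 1 : ℕ) : ℝ) / (N : ℝ) ^ (-(2 : ℝ) / 3) + 2) ≤ ε / 2 * N := by
  have hlog := (isLittleO_log_rpow_atTop (show (0 : ℝ) < 1 / 6 by norm_num)).bound
    (show 0 < ε / 18 by positivity)
  filter_upwards [hlog, Real.tendsto_log_atTop.eventually_ge_atTop 6] with r hr h6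
  rintro N hN rfl Δ hΔ
  have hN1 : (1 : ℝ) ≤ N := by exact_mod_cast hN
  have hN0 : (0 : ℝ) < N := by linarith
  rw [Real.norm_of_nonneg (by linarith), Real.norm_of_nonneg (by positivity)] at hr
  have hK : ((Nat.log 2 N : ℕ) : ℝ) ≤ 2 * Real.log N := by
    have h1 : (2 : ℝ) ^ Nat.log 2 N ≤ N := by exact_mod_cast Nat.pow_log_le_self 2 hN.ne'
    have h2 := Real.log_le_log (by positivity) h1
    rw [Real.log_pow] at h2
    nlinarith [Real.log_two_gt_d9, (Nat.cast_nonneg (Nat.log 2 N) : (0 : ℝ) ≤ _)]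
  have hw : ((N : ℝ) ^ (-(2 : ℝ) / 3))⁻¹ = (N : ℝ) ^ (2 / 3 : ℝ) := by
    rw [← Real.rpow_neg hN0.le]
    norm_num
  have hp1 : (1 : ℝ) ≤ (N : ℝ) ^ (2 / 3 : ℝ) := Real.one_le_rpow hN1 (by norm_num)
  have hp : (N : ℝ) ^ (1 / 6 : ℝ) * (N : ℝ) ^ (2 / 3 : ℝ) * (N : ℝ) ^ (1 / 6 : ℝ) = N := by
    rw [← Real.rpow_add hN0, ← Real.rpow_add hN0]
    norm_num
  have hq : (0 : ℝ) < (N : ℝ) ^ (1 / 6 : ℝ) := Real.rpow_pos_of_pos hN0 _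
  have hp0 : (0 : ℝ) < (N : ℝ) ^ (2 / 3 : ℝ) := by linarith
  rw [div_eq_mul_inv, hw]
  push_cast
  calc Δ * (4 * ((Nat.log 2 N : ℝ) + 1) * (N : ℝ) ^ (2 / 3 : ℝ) + 2)
      ≤ (N : ℝ) ^ (1 / 6 : ℝ) * (4 * ((Nat.log 2 N : ℝ) + 1) * (N : ℝ) ^ (2 / 3 : ℝ) + 2) := by
        gcongr
    _ ≤ (N : ℝ) ^ (1 / 6 : ℝ) * ((N : ℝ) ^ (2 / 3 : ℝ) * (9 * Real.log N)) := by
        gcongr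
        nlinarith
    _ ≤ (N : ℝ) ^ (1 / 6 : ℝ) *
          ((N : ℝ) ^ (2 / 3 : ℝ) * (9 * (ε / 18 * (N : ℝ) ^ (1 / 6 : ℝ)))) := by
        gcongr
    _ = ε / 2 * ((N : ℝ) ^ (1 / 6 : ℝ) * (N : ℝ) ^ (2 / 3 : ℝ) * (N : ℝ) ^ (1 / 6 : ℝ)) := by
        ring
    _ = ε / 2 * N := by rw [hp]

/-- For every `ε > 0`, the probability (over the exposure process generating the
uniform pairing) that `P^t(x, π(y)) ≤ (𝔚 - ε)/N` is `o(1/N²)`. -/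
theorem completion_lemma
    (k : ℕ → ℕ) (dg : ∀ n, Fin (k n) → ℕ)
    (hN : Tendsto (fun n => (Nh (dg n) : ℝ)) atTop atTop)
    (heven : ∀ n, Even (Nh (dg n)))
    (hmin : ∀ n v, 3 ≤ dg n v)
    (hΔ : Tendsto (fun n => Real.log (DeltaD (dg n)) / Real.log (Nh (dg n)))
      atTop (nhds 0))
    (h1 : Tendsto (fun n =>
        sigsq (dg n) / muD (dg n) ^ 3 * Real.log (Nh (dg n)) /
          Real.log (Real.log (Nh (dg n))) ^ 2) atTop atTop)
    (h2 : Tendsto (fun n =>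
        Real.sqrt (sigsq (dg n)) ^ 3 / (rhoD (dg n) * Real.sqrt (muD (dg n))) *
          Real.sqrt (Real.log (Nh (dg n)))) atTop atTop)
    (x y : ∀ n, HE (k n) (dg n)) (hxy : ∀ n, x n ≠ y n)
    (lam : ℝ) (t : ℕ → ℕ)
    (ht : Tendsto (fun n => ((t n : ℝ) - tstar (dg n) - lam * wstar (dg n)) / wstar (dg n))
      atTop (nhds 0))
    :
    ∀ ε > (0 : ℝ), Tendsto (fun n =>
      (Nh (dg n) : ℝ) ^ 2 * prP (dg n) (fun π =>
        ((nbrwP (dg n) π) ^ (t n)) (x n) (π (y n)) ≤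
          (Wle (expFinal (dg n) π (t n / 2) (wminD (dg n)) (x n) (y n))
              (t n / 2) (x n) (y n) (thetaD (dg n)) - ε) / (Nh (dg n) : ℝ)))
      atTop (nhds 0) := by
  intro ε hε
  have hL : Tendsto (fun n => Real.log (Nh (dg n))) atTop atTop := Real.tendsto_log_atTop.comp hN
  have hbound : Tendsto (fun n => Real.exp (Real.log (Nh (dg n)) *
      (2 - ε ^ 2 / 128 * Real.log (Nh (dg n))))) atTop (nhds 0) := by
    refine Real.tendsto_exp_atBot.comp (hL.atTop_mul_atBot₀ ?_)
    exact tendsto_atBot_add_const_left _ 2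
      (tendsto_neg_atTop_atBot.comp (hL.const_mul_atTop (by positivity : 0 < ε ^ 2 / 128)))
  refine squeeze_zero' (Eventually.of_forall fun n => ?_) ?_ hbound
  · unfold prP
    positivity
  · filter_upwards [hN.eventually (eventually_degree_bound hε), hN.eventually_ge_atTop 3,
      hΔ.eventually_le_const (show (0 : ℝ) < 1 / 6 by norm_num)] with n hn hn3 hnΔ
    have hN0 : (0 : ℝ) < Nh (dg n) := by linarith
    have hL0 : 0 < Real.log (Nh (dg n)) := Real.log_pos (by linarith)
    have hNn : 0 < Nh (dg n) := by exact_mod_cast hN0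
    have hΔ' : (DeltaD (dg n) : ℝ) ≤ (Nh (dg n) : ℝ) ^ (1 / 6 : ℝ) := by
      rw [div_le_iff₀ hL0] at hnΔ
      rw [Real.rpow_def_of_pos hN0, mul_comm]
      exact (Real.le_exp_log _).trans (Real.exp_le_exp.2 hnΔ)
    have h := prP_lower_tail_le (hmin n) (hxy n) (t n) (wmin := wminD (dg n))
      (θ := thetaD (dg n)) (K := Nat.log 2 (Nh (dg n)) + 1) (Real.rpow_pos_of_pos hN0 _)
      (lt_log_of_rpow_lt_pow hNn) (by unfold thetaD; positivity) hε hNn (hn _ hNn rfl _ hΔ')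
    refine (mul_le_mul_of_nonneg_left h (by positivity)).trans_eq ?_
    have e : (Nh (dg n) : ℝ) ^ 2 = Real.exp (2 * Real.log (Nh (dg n))) := by
      rw [two_mul, Real.exp_add, Real.exp_log hN0, sq]
    have e' : ε ^ 2 / (128 * (Nh (dg n) * thetaD (dg n))) =
        ε ^ 2 / 128 * Real.log (Nh (dg n)) ^ 2 := by
      unfold thetaD
      field_simp
    rw [e', e, ← Real.exp_add]
    congr 1
    ring

end
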